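/- arXiv:2210.14051 — 6 statements merged into one kernel-verified Lean document; each statement's English description precedes it below -/
import Mathlib

section
/- Let β ≠ 0, let n ≥ 2 be an integer, and let F_1,…,F_n be probability measures on ℝ, each with finite ∫ exp(β x) integral, satisfying U_β(F_1) ≤ U_β(F_2) ≤ … ≤ U_β(F_n). Let θ and θ' be probability vectors in the n-simplex and let 1 ≤ i < j ≤ n be indices such that θ'_i ≤ θ_i, θ'_j ≥ θ_j, and θ'_k = θ_k for all k ∉ {i, j}. Then U_β(Σ_{k=1}^n θ_k·F_k) ≤ U_β(Σ_{k=1}^n θ'_k·F_k). (Monotonicity-preserving under pairwise transport.) -/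
open MeasureTheory

/-- The entropic risk measure `U_β(μ) = β⁻¹ log (∫ exp (β x) dμ(x))`. -/
noncomputable def entRM (β : ℝ) (μ : Measure ℝ) : ℝ :=
  β⁻¹ * Real.log (∫ x, Real.exp (β * x) ∂μ)

/-- The mixture `∑ i, θ i • μ i` of finitely many measures on ℝ. -/
noncomputable def mixN {n : ℕ} (θ : Fin n → ℝ) (μ : Fin n → Measure ℝ) : Measure ℝ :=
  ∑ i, ENNReal.ofReal (θ i) • μ i

theorem inv_mul_log_le_inv_mul_log_iff {β a b : ℝ} (hβ : β ≠ 0) (ha : 0 < a) (hb : 0 < b) :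
    β⁻¹ * Real.log a ≤ β⁻¹ * Real.log b ↔ β⁻¹ * a ≤ β⁻¹ * b := by
  rcases hβ.lt_or_gt with h | h
  · rw [mul_le_mul_left_of_neg (inv_lt_zero.2 h), mul_le_mul_left_of_neg (inv_lt_zero.2 h),
      Real.log_le_log_iff hb ha]
  · rw [mul_le_mul_iff_right₀ (inv_pos.2 h), mul_le_mul_iff_right₀ (inv_pos.2 h),
      Real.log_le_log_iff ha hb]

theorem integral_mixN {n : ℕ} {θ : Fin n → ℝ} {μ : Fin n → Measure ℝ} {f : ℝ → ℝ}
    (hθ : ∀ i, 0 ≤ θ i) (hf : ∀ i, Integrable f (μ i)) :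
    ∫ x, f x ∂(mixN θ μ) = ∑ i, θ i * ∫ x, f x ∂(μ i) := by
  rw [mixN, integral_finsetSum_measure fun i _ => (hf i).smul_measure ENNReal.ofReal_ne_top]
  exact Finset.sum_congr rfl fun i _ => by
    rw [integral_smul_measure, ENNReal.toReal_ofReal (hθ i), smul_eq_mul]

theorem sum_mul_pos_of_sum_eq_one {ι : Type*} [Fintype ι] {θ m : ι → ℝ}
    (hθ : ∀ i, 0 ≤ θ i) (hsum : ∑ i, θ i = 1) (hm : ∀ i, 0 < m i) :
    0 < ∑ i, θ i * m i := by
  obtain ⟨k, hk, hk0⟩ := Finset.exists_ne_zero_of_sum_ne_zero (hsum.trans_ne one_ne_zero)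
  exact Finset.sum_pos' (fun i _ => mul_nonneg (hθ i) (hm i).le)
    ⟨k, hk, mul_pos ((hθ k).lt_of_ne' hk0) (hm k)⟩

theorem sum_sub_mul_of_eq_off_pair {ι : Type*} [Fintype ι] {θ θ' : ι → ℝ} {i j : ι}
    (hij : i ≠ j) (hsum : ∑ k, θ k = ∑ k, θ' k)
    (hk : ∀ k, k ≠ i → k ≠ j → θ' k = θ k) (m : ι → ℝ) :
    ∑ k, θ' k * m k - ∑ k, θ k * m k = (θ i - θ' i) * (m j - m i) := by
  have key (c : ι → ℝ) : ∑ k, (θ' k - θ k) * c k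
      = (θ' i - θ i) * c i + (θ' j - θ j) * c j :=
    Fintype.sum_eq_add i j hij fun k hne => by rw [hk k hne.1 hne.2, sub_self, zero_mul]
  have hmass := key 1
  have hval := key m
  simp only [Pi.one_apply, mul_one, Finset.sum_sub_distrib, sub_mul] at hmass hval
  linear_combination hval - m j * (hsum + hmass)

/-- Monotonicity-preserving under pairwise transport: moving probability mass from a
lower-value component `i` to a higher-value component `j` cannot decrease `U_β` of the
mixture. -/
theorem entRM_pairwise_transport
    (β : ℝ) (hβ : β ≠ 0) (n : ℕ) (hn : 2 ≤ n)
    (F : Fin n → Measure ℝ) [∀ i, IsProbabilityMeasure (F i)]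
    (hFi : ∀ i, Integrable (fun x => Real.exp (β * x)) (F i))
    (hmono : ∀ i j : Fin n, i ≤ j → entRM β (F i) ≤ entRM β (F j))
    (θ θ' : Fin n → ℝ)
    (hθ0 : ∀ i, 0 ≤ θ i) (hθ1 : ∑ i, θ i = 1)
    (hθ'0 : ∀ i, 0 ≤ θ' i) (hθ'1 : ∑ i, θ' i = 1)
    (i j : Fin n) (hij : i < j)
    (hi : θ' i ≤ θ i) (hj : θ j ≤ θ' j)
    (hk : ∀ k, k ≠ i → k ≠ j → θ' k = θ k) :
    entRM β (mixN θ F) ≤ entRM β (mixN θ' F) := by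
  have hM (k : Fin n) : 0 < ∫ x, Real.exp (β * x) ∂(F k) := integral_exp_pos (hFi k)
  have hpair := hmono i j hij.le
  rw [entRM, entRM, inv_mul_log_le_inv_mul_log_iff hβ (hM i) (hM j)] at hpair
  rw [entRM, entRM, integral_mixN hθ0 hFi, integral_mixN hθ'0 hFi,
    inv_mul_log_le_inv_mul_log_iff hβ (sum_mul_pos_of_sum_eq_one hθ0 hθ1 hM)
      (sum_mul_pos_of_sum_eq_one hθ'0 hθ'1 hM), ← sub_nonneg, ← mul_sub,
    sum_sub_mul_of_eq_off_pair hij.ne (hθ1.trans hθ'1.symm) hk, mul_left_comm, mul_sub]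
  exact mul_nonneg (sub_nonneg.2 hi) (sub_nonneg.2 hpair)
end

section
/- Let β ≠ 0 and M > 0, and let μ, ν be probability measures on ℝ supported in [0, M]. Then |E_β(μ) − E_β(ν)| ≤ |exp(β M) − 1| · sup_{x ∈ ℝ} |F_μ(x) − F_ν(x)|. (Lipschitz property of the exponential utility with respect to the supremum norm of CDFs, with constant L_M = |exp(βM) − 1|.) -/
open MeasureTheory

/-- The exponential utility `E_β(μ) = ∫ exp (β x) dμ(x)`. -/
noncomputable def expUtility (β : ℝ) (μ : Measure ℝ) : ℝ :=
  ∫ x, Real.exp (β * x) ∂μ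

/-- The cumulative distribution function of a measure on ℝ. -/
noncomputable def cdfR (μ : Measure ℝ) (x : ℝ) : ℝ :=
  (μ (Set.Iic x)).toReal

theorem integrableOn_mul_exp_Icc (β M : ℝ) :
    IntegrableOn (fun t => β * Real.exp (β * t)) (Set.Icc 0 M) :=
  (by fun_prop : Continuous fun t => β * Real.exp (β * t)).continuousOn.integrableOn_Icc

theorem integral_Icc_mul_exp (β : ℝ) {x M : ℝ} (hx : x ≤ M) :
    ∫ t in Set.Icc x M, β * Real.exp (β * t) = Real.exp (β * M) - Real.exp (β * x) := by
  rw [integral_Icc_eq_integral_Ioc, ← intervalIntegral.integral_of_le hx]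
  refine intervalIntegral.integral_eq_sub_of_hasDerivAt
    (f := fun t => Real.exp (β * t)) (fun t _ => ?_)
    (Continuous.intervalIntegrable (by fun_prop) _ _)
  simpa [mul_comm] using ((hasDerivAt_id t).const_mul β).exp

/-- Integration by parts against the cumulative distribution function. -/
theorem expUtility_eq_sub_integral_cdfR (β M : ℝ) (μ : Measure ℝ) [IsProbabilityMeasure μ]
    (hμ : μ (Set.Icc (0 : ℝ) M) = 1) :
    expUtility β μ =
      Real.exp (β * M) - ∫ t in Set.Icc 0 M, β * Real.exp (β * t) * cdfR μ t := by
  have h_supp : ∀ᵐ x ∂μ, x ∈ Set.Icc 0 M :=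
    (mem_ae_iff_prob_eq_one measurableSet_Icc).2 hμ
  have h_int : Integrable (Function.uncurry fun x t : ℝ =>
      (Set.Ici x).indicator (fun t => β * Real.exp (β * t)) t)
      (μ.prod (volume.restrict (Set.Icc 0 M))) := by
    exact (Integrable.comp_snd (integrableOn_mul_exp_Icc β M) μ).indicator
      (measurableSet_le measurable_fst measurable_snd)
  have h_fst (x : ℝ) (hx : x ∈ Set.Icc 0 M) :
      ∫ t in Set.Icc 0 M, (Set.Ici x).indicator (fun t => β * Real.exp (β * t)) t =
        Real.exp (β * M) - Real.exp (β * x) := by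
    rw [setIntegral_indicator measurableSet_Ici, ← integral_Icc_mul_exp β hx.2]
    congr 2
    ext t
    simp only [Set.mem_inter_iff, Set.mem_Icc, Set.mem_Ici]
    exact ⟨fun h => ⟨h.2, h.1.2⟩, fun h => ⟨⟨hx.1.trans h.1, h.2⟩, h.1⟩⟩
  have h_snd (t : ℝ) :
      ∫ x, (Set.Ici x).indicator (fun t => β * Real.exp (β * t)) t ∂μ =
        β * Real.exp (β * t) * cdfR μ t := by
    have h : (fun x => (Set.Ici x).indicator (fun t => β * Real.exp (β * t)) t) =
        (Set.Iic t).indicator fun _ => β * Real.exp (β * t) := by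
      ext x
      simp [Set.indicator_apply]
    rw [h, integral_indicator_const _ measurableSet_Iic, smul_eq_mul, mul_comm]
    rfl
  have h_swap := integral_integral_swap h_int
  simp only [h_snd] at h_swap
  rw [← h_swap, expUtility]
  have h_eq : (fun x => Real.exp (β * x)) =ᵐ[μ] fun x => Real.exp (β * M) -
      ∫ t in Set.Icc 0 M, (Set.Ici x).indicator (fun t => β * Real.exp (β * t)) t := by
    filter_upwards [h_supp] with x hx
    rw [h_fst x hx, sub_sub_cancel]
  have h_left := h_int.integral_prod_left
  simp only [Function.uncurry_apply_pair] at h_left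
  rw [integral_congr_ae h_eq, integral_sub (integrable_const _) h_left]
  simp

theorem monotone_cdfR (μ : Measure ℝ) [IsFiniteMeasure μ] : Monotone (cdfR μ) :=
  fun _ _ h => measureReal_mono (Set.Iic_subset_Iic.2 h)

theorem cdfR_mem_Icc (μ : Measure ℝ) [IsProbabilityMeasure μ] (x : ℝ) :
    cdfR μ x ∈ Set.Icc 0 1 :=
  ⟨ENNReal.toReal_nonneg, measureReal_le_one⟩

theorem integrableOn_mul_exp_mul_cdfR (β M : ℝ) (μ : Measure ℝ) [IsProbabilityMeasure μ] :
    IntegrableOn (fun t => β * Real.exp (β * t) * cdfR μ t) (Set.Icc 0 M) :=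
  (integrableOn_mul_exp_Icc β M).mul_bdd (c := 1)
    (monotone_cdfR μ).measurable.aestronglyMeasurable
    (.of_forall fun t => by
      rw [Real.norm_of_nonneg (cdfR_mem_Icc μ t).1]
      exact (cdfR_mem_Icc μ t).2)

theorem abs_cdfR_sub_le_iSup (μ ν : Measure ℝ) [IsProbabilityMeasure μ]
    [IsProbabilityMeasure ν] (t : ℝ) :
    |cdfR μ t - cdfR ν t| ≤ ⨆ x : ℝ, |cdfR μ x - cdfR ν x| := by
  refine le_ciSup (f := fun x => |cdfR μ x - cdfR ν x|) ⟨1, ?_⟩ t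
  rintro _ ⟨x, rfl⟩
  have hx := cdfR_mem_Icc μ x
  have hy := cdfR_mem_Icc ν x
  exact abs_le.2 ⟨by linarith [hx.1, hy.2], by linarith [hx.2, hy.1]⟩

theorem integral_Icc_abs_mul_exp (β : ℝ) {M : ℝ} (hM : 0 ≤ M) :
    ∫ t in Set.Icc 0 M, |β * Real.exp (β * t)| = |Real.exp (β * M) - 1| := by
  have h := integral_Icc_mul_exp β hM
  rw [mul_zero, Real.exp_zero] at h
  rw [← h]
  simp only [abs_mul, Real.abs_exp, integral_const_mul]
  rw [abs_of_nonneg (integral_nonneg fun t => (Real.exp_pos (β * t)).le)]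

/-- Lipschitz property of the exponential utility with respect to the supremum norm of
CDFs, over distributions supported in `[0, M]`, with constant `|exp (β M) - 1|`. -/
theorem expUtility_lipschitz
    (β M : ℝ) (hβ : β ≠ 0) (hM : 0 < M)
    (μ ν : Measure ℝ) [IsProbabilityMeasure μ] [IsProbabilityMeasure ν]
    (hμ : μ (Set.Icc (0 : ℝ) M) = 1) (hν : ν (Set.Icc (0 : ℝ) M) = 1) :
    |expUtility β μ - expUtility β ν| ≤
      |Real.exp (β * M) - 1| * ⨆ x : ℝ, |cdfR μ x - cdfR ν x| := by
  rw [expUtility_eq_sub_integral_cdfR β M μ hμ, expUtility_eq_sub_integral_cdfR β M ν hν,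
    sub_sub_sub_cancel_left, abs_sub_comm, ← integral_sub
      (integrableOn_mul_exp_mul_cdfR β M μ) (integrableOn_mul_exp_mul_cdfR β M ν),
    ← integral_Icc_abs_mul_exp β hM.le, ← integral_mul_const, ← Real.norm_eq_abs]
  refine norm_integral_le_of_norm_le
    ((integrableOn_mul_exp_Icc β M).abs.mul_const _) (.of_forall fun t => ?_)
  rw [← mul_sub, norm_mul]
  exact mul_le_mul_of_nonneg_left (abs_cdfR_sub_le_iSup μ ν t) (abs_nonneg _)
end

section
/- Let β ≠ 0, M > 0, and μ₁, μ₂ ∈ (0,1). Define the probability measures F = (1−μ₁)·δ_0 + μ₁·δ_M and G = (1−μ₂)·δ_0 + μ₂·δ_M, where δ_c denotes the Dirac measure at c. Then sup_{x ∈ ℝ} |F_F(x) − F_G(x)| = |μ₁ − μ₂| and |E_β(F) − E_β(G)| = |exp(β M) − 1| · |μ₁ − μ₂|; in particular the Lipschitz constant |exp(βM) − 1| of the exponential utility with respect to the supremum norm over distributions supported in [0,M] is tight. -/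
open MeasureTheory

/-- The CDF of a scaled Bernoulli distribution with parameter `p`. -/
lemma cdfR_scaled_bernoulli {p M : ℝ} (hp : p ∈ Set.Icc (0 : ℝ) 1) (x : ℝ) :
    cdfR (ENNReal.ofReal (1 - p) • Measure.dirac (0 : ℝ) +
      ENNReal.ofReal p • Measure.dirac M) x =
      (if 0 ≤ x then 1 - p else 0) + (if M ≤ x then p else 0) := by
  have hq : 0 ≤ 1 - p := sub_nonneg.mpr hp.2
  simp only [cdfR, Measure.add_apply, Measure.smul_apply, smul_eq_mul,
    Measure.dirac_apply' _ measurableSet_Iic, Set.indicator_apply, Set.mem_Iic, Pi.one_apply]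
  split_ifs <;> simp [ENNReal.toReal_add, ENNReal.toReal_ofReal, hp.1, hq]

/-- The exponential utility of a scaled Bernoulli distribution with parameter `p`. -/
lemma expUtility_scaled_bernoulli {p : ℝ} (hp : p ∈ Set.Icc (0 : ℝ) 1) (β M : ℝ) :
    expUtility β (ENNReal.ofReal (1 - p) • Measure.dirac (0 : ℝ) +
      ENNReal.ofReal p • Measure.dirac M) = (1 - p) + p * Real.exp (β * M) := by
  have hint (c a : ℝ) :
      Integrable (fun x => Real.exp (β * x)) (ENNReal.ofReal c • Measure.dirac a) :=
    (integrable_dirac (by simp)).smul_measure ENNReal.ofReal_ne_top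
  rw [expUtility, integral_add_measure (hint _ _) (hint _ _), integral_smul_measure,
    integral_smul_measure, integral_dirac, integral_dirac,
    ENNReal.toReal_ofReal (sub_nonneg.mpr hp.2), ENNReal.toReal_ofReal hp.1]
  simp

/-- Tightness of the Lipschitz constant `|exp (β M) - 1|` of the exponential utility:
for the scaled Bernoulli distributions `F = (1-μ₁) δ_0 + μ₁ δ_M` and
`G = (1-μ₂) δ_0 + μ₂ δ_M`, the sup distance of CDFs equals `|μ₁ - μ₂|` and the
difference of exponential utilities equals `|exp (β M) - 1| * |μ₁ - μ₂|`. -/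
theorem expUtility_lipschitz_tight
    (β M : ℝ) (hβ : β ≠ 0) (hM : 0 < M)
    (μ₁ μ₂ : ℝ) (h₁ : μ₁ ∈ Set.Ioo (0 : ℝ) 1) (h₂ : μ₂ ∈ Set.Ioo (0 : ℝ) 1)
    (F G : Measure ℝ)
    (hF : F = ENNReal.ofReal (1 - μ₁) • Measure.dirac (0 : ℝ) +
              ENNReal.ofReal μ₁ • Measure.dirac M)
    (hG : G = ENNReal.ofReal (1 - μ₂) • Measure.dirac (0 : ℝ) +
              ENNReal.ofReal μ₂ • Measure.dirac M) :
    (⨆ x : ℝ, |cdfR F x - cdfR G x|) = |μ₁ - μ₂| ∧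
      |expUtility β F - expUtility β G| = |Real.exp (β * M) - 1| * |μ₁ - μ₂| := by
  subst hF hG
  have h₁' := Set.Ioo_subset_Icc_self h₁
  have h₂' := Set.Ioo_subset_Icc_self h₂
  constructor
  · simp only [cdfR_scaled_bernoulli h₁', cdfR_scaled_bernoulli h₂']
    refine IsLUB.ciSup_eq (IsGreatest.isLUB ⟨⟨0, ?_⟩, ?_⟩)
    · simp [hM.not_ge, abs_sub_comm]
    · rintro _ ⟨x, rfl⟩
      dsimp only
      split_ifs <;> simp [abs_sub_comm]
  · rw [expUtility_scaled_bernoulli h₁', expUtility_scaled_bernoulli h₂', ← abs_mul]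
    congr 1
    ring
end

section
/- Let a < b be reals, let c ∈ (0,1), let μ be a probability measure on ℝ supported in [a,b] with CDF F, and define the distributional optimism operator by (O_c F)(x) = max(F(x) − c·𝟙_{[a,b)}(x), 0), where 𝟙_{[a,b)} is the indicator of [a,b). If ν is any probability measure on ℝ supported in [a,b] with CDF G satisfying sup_{x ∈ ℝ} |F(x) − G(x)| ≤ c, then (O_c F)(x) ≤ G(x) for every x ∈ ℝ; consequently, for β ≠ 0, any probability measure on [a,b] whose CDF equals O_c F satisfies U_β(O_c F) ≥ U_β(ν) for every such ν. -/
open MeasureTheory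

/-- The distributional optimism operator on CDFs supported in `[a, b]`:
`(O_c F)(x) = max (F x - c · 𝟙_{[a,b)}(x)) 0`. -/
noncomputable def optOp (a b c : ℝ) (F : ℝ → ℝ) (x : ℝ) : ℝ :=
  max (F x - c * Set.indicator (Set.Ico a b) (fun _ => (1 : ℝ)) x) 0

lemma ae_mem_Icc_of_measure_eq_one {a b : ℝ} {μ : Measure ℝ} [IsProbabilityMeasure μ]
    (h : μ (Set.Icc a b) = 1) : ∀ᵐ x ∂μ, x ∈ Set.Icc a b :=
  (prob_compl_eq_zero_iff measurableSet_Icc).2 h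

lemma cdfR_eq_zero_of_lt {a b x : ℝ} {μ : Measure ℝ} [IsProbabilityMeasure μ]
    (h : μ (Set.Icc a b) = 1) (hx : x < a) : cdfR μ x = 0 := by
  have h0 : μ (Set.Iic x) = 0 := by
    refine measure_mono_null (fun y hy => ?_) ((prob_compl_eq_zero_iff measurableSet_Icc).2 h)
    exact fun hy' => absurd (hy'.1.trans hy) (not_le.2 hx)
  simp [cdfR, h0]

lemma cdfR_eq_one_of_le {a b x : ℝ} {μ : Measure ℝ} [IsProbabilityMeasure μ]
    (h : μ (Set.Icc a b) = 1) (hx : b ≤ x) : cdfR μ x = 1 := by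
  have h1 : μ (Set.Iic x) = 1 :=
    le_antisymm prob_le_one (h ▸ measure_mono fun y hy => hy.2.trans hx)
  simp [cdfR, h1]

lemma integrable_exp_mul_of_measure_Icc_eq_one {a b : ℝ} {μ : Measure ℝ}
    [IsProbabilityMeasure μ] (h : μ (Set.Icc a b) = 1) (β : ℝ) :
    Integrable (fun x => Real.exp (β * x)) μ :=
  ProbabilityTheory.integrable_exp_mul_of_mem_Icc aemeasurable_id
    (ae_mem_Icc_of_measure_eq_one h)

lemma measure_Iic_le_of_cdfR_le {μ ν : Measure ℝ} [IsProbabilityMeasure μ]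
    [IsProbabilityMeasure ν] {x : ℝ} (h : cdfR μ x ≤ cdfR ν x) :
    μ (Set.Iic x) ≤ ν (Set.Iic x) :=
  (ENNReal.toReal_le_toReal (measure_ne_top _ _) (measure_ne_top _ _)).1 h

lemma measure_Ioi_le_of_cdfR_le {μ ν : Measure ℝ} [IsProbabilityMeasure μ]
    [IsProbabilityMeasure ν] {x : ℝ} (h : cdfR μ x ≤ cdfR ν x) :
    ν (Set.Ioi x) ≤ μ (Set.Ioi x) := by
  rw [← Set.compl_Iic, prob_compl_eq_one_sub measurableSet_Iic,
    prob_compl_eq_one_sub measurableSet_Iic]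
  exact tsub_le_tsub_left (measure_Iic_le_of_cdfR_le h) 1

lemma integral_exp_mul_le_of_cdfR_le_of_pos {μ ν : Measure ℝ} [IsProbabilityMeasure μ]
    [IsProbabilityMeasure ν] (h : ∀ x, cdfR μ x ≤ cdfR ν x) {β : ℝ} (hβ : 0 < β)
    (hμ : Integrable (fun x => Real.exp (β * x)) μ) :
    ∫ x, Real.exp (β * x) ∂ν ≤ ∫ x, Real.exp (β * x) ∂μ := by
  have hm : Measurable fun x : ℝ => Real.exp (β * x) := by fun_prop
  have h0 : ∀ m : Measure ℝ, 0 ≤ᵐ[m] fun x => Real.exp (β * x) :=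
    fun m => ae_of_all _ fun x => (Real.exp_pos _).le
  rw [integral_eq_lintegral_of_nonneg_ae (h0 ν) hm.aestronglyMeasurable,
    integral_eq_lintegral_of_nonneg_ae (h0 μ) hm.aestronglyMeasurable]
  refine ENNReal.toReal_mono hμ.lintegral_lt_top.ne ?_
  rw [lintegral_eq_lintegral_meas_lt ν (h0 ν) hm.aemeasurable,
    lintegral_eq_lintegral_meas_lt μ (h0 μ) hm.aemeasurable]
  refine setLIntegral_mono' measurableSet_Ioi fun t ht => ?_
  have hs : {x : ℝ | t < Real.exp (β * x)} = Set.Ioi (Real.log t / β) := by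
    ext x
    rw [Set.mem_ofPred_eq, Set.mem_Ioi, div_lt_iff₀' hβ, Real.log_lt_iff_lt_exp ht]
  rw [hs]
  exact measure_Ioi_le_of_cdfR_le (h _)

lemma integral_exp_mul_le_of_cdfR_le_of_neg {μ ν : Measure ℝ} [IsProbabilityMeasure μ]
    [IsProbabilityMeasure ν] (h : ∀ x, cdfR μ x ≤ cdfR ν x) {β : ℝ} (hβ : β < 0)
    (hν : Integrable (fun x => Real.exp (β * x)) ν) :
    ∫ x, Real.exp (β * x) ∂μ ≤ ∫ x, Real.exp (β * x) ∂ν := by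
  have hm : Measurable fun x : ℝ => Real.exp (β * x) := by fun_prop
  have h0 : ∀ m : Measure ℝ, 0 ≤ᵐ[m] fun x => Real.exp (β * x) :=
    fun m => ae_of_all _ fun x => (Real.exp_pos _).le
  rw [integral_eq_lintegral_of_nonneg_ae (h0 ν) hm.aestronglyMeasurable,
    integral_eq_lintegral_of_nonneg_ae (h0 μ) hm.aestronglyMeasurable]
  refine ENNReal.toReal_mono hν.lintegral_lt_top.ne ?_
  rw [lintegral_eq_lintegral_meas_le ν (h0 ν) hm.aemeasurable,
    lintegral_eq_lintegral_meas_le μ (h0 μ) hm.aemeasurable]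
  refine setLIntegral_mono' measurableSet_Ioi fun t ht => ?_
  have hs : {x : ℝ | t ≤ Real.exp (β * x)} = Set.Iic (Real.log t / β) := by
    ext x
    rw [Set.mem_ofPred_eq, Set.mem_Iic, le_div_iff_of_neg' hβ, Real.log_le_iff_le_exp ht]
  rw [hs]
  exact measure_Iic_le_of_cdfR_le (h _)

/-- The entropic risk measure is monotone for stochastic dominance. -/
lemma entRM_le_of_cdfR_le {μ ν : Measure ℝ} [IsProbabilityMeasure μ]
    [IsProbabilityMeasure ν] (h : ∀ x, cdfR μ x ≤ cdfR ν x) {β : ℝ} (hβ : β ≠ 0)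
    (hμ : Integrable (fun x => Real.exp (β * x)) μ)
    (hν : Integrable (fun x => Real.exp (β * x)) ν) : entRM β ν ≤ entRM β μ := by
  unfold entRM
  rcases hβ.lt_or_gt with hneg | hpos
  · exact mul_le_mul_of_nonpos_left (Real.log_le_log (integral_exp_pos hμ)
      (integral_exp_mul_le_of_cdfR_le_of_neg h hneg hν)) (inv_nonpos.2 hneg.le)
  · exact mul_le_mul_of_nonneg_left (Real.log_le_log (integral_exp_pos hν)
      (integral_exp_mul_le_of_cdfR_le_of_pos h hpos hμ)) (inv_nonneg.2 hpos.le)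

/-- The optimistic CDF `O_c F` lies below the CDF of any distribution within sup-distance
`c` of `F`; consequently any measure whose CDF is `O_c F` has the largest entropic risk
value among all such distributions. -/
theorem optOp_dominates
    (a b : ℝ) (hab : a < b) (c : ℝ) (hc : c ∈ Set.Ioo (0 : ℝ) 1)
    (μ ν : Measure ℝ) [IsProbabilityMeasure μ] [IsProbabilityMeasure ν]
    (hμ : μ (Set.Icc a b) = 1) (hν : ν (Set.Icc a b) = 1)
    (hclose : ∀ x, |cdfR μ x - cdfR ν x| ≤ c) :
    (∀ x, optOp a b c (cdfR μ) x ≤ cdfR ν x) ∧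
      (∀ β : ℝ, β ≠ 0 → ∀ ρ : Measure ℝ, IsProbabilityMeasure ρ →
        ρ (Set.Icc a b) = 1 → (∀ x, cdfR ρ x = optOp a b c (cdfR μ) x) →
          entRM β ν ≤ entRM β ρ) := by
  have hdom : ∀ x, optOp a b c (cdfR μ) x ≤ cdfR ν x := by
    intro x
    refine max_le ?_ ENNReal.toReal_nonneg
    by_cases hx : x ∈ Set.Ico a b
    · rw [Set.indicator_of_mem hx]
      linarith [(abs_le.1 (hclose x)).2]
    · rw [Set.indicator_of_notMem hx, mul_zero, sub_zero]
      rcases lt_or_ge x a with hxa | hxa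
      · rw [cdfR_eq_zero_of_lt hμ hxa, cdfR_eq_zero_of_lt hν hxa]
      · have hxb : b ≤ x := not_lt.1 fun h => hx ⟨hxa, h⟩
        rw [cdfR_eq_one_of_le hμ hxb, cdfR_eq_one_of_le hν hxb]
  refine ⟨hdom, fun β hβ ρ _ hρ hcdf => ?_⟩
  exact entRM_le_of_cdfR_le (fun x => (hcdf x).trans_le (hdom x)) hβ
    (integrable_exp_mul_of_measure_Icc_eq_one hρ β)
    (integrable_exp_mul_of_measure_Icc_eq_one hν β)
end

section
/- Let p and ε be reals with 0 < p, 0 ≤ ε, and p + ε ≤ 1/2. Then kl(p, p+ε) ≤ ε² / (2·p·(1−p)) ≤ ε² / p, where kl(p,q) = p·log(p/q) + (1−p)·log((1−p)/(1−q)) is the Kullback–Leibler divergence between Bernoulli distributions with parameters p and q. -/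
/-- The Kullback–Leibler divergence between Bernoulli distributions with
parameters `p` and `q`. -/
noncomputable def klBer (p q : ℝ) : ℝ :=
  p * Real.log (p / q) + (1 - p) * Real.log ((1 - p) / (1 - q))

/-- The quadratic upper bound on `q ↦ kl(p, q)` minus `kl(p, q)` itself, up to a constant,
is monotone between `p` and `1/2`. -/
theorem monotoneOn_quadratic_add_log {p : ℝ} (hp : 0 < p) (hp' : p ≤ 1 / 2) :
    MonotoneOn
      (fun x : ℝ => (x - p) ^ 2 / (2 * p * (1 - p)) + (p * Real.log x + (1 - p) * Real.log (1 - x)))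
      (Set.Icc p (1 / 2)) := by
  have hderiv : ∀ x ∈ Set.Icc p (1 / 2), HasDerivAt
      (fun x : ℝ => (x - p) ^ 2 / (2 * p * (1 - p)) + (p * Real.log x + (1 - p) * Real.log (1 - x)))
      ((x - p) / (p * (1 - p)) - (x - p) / (x * (1 - x))) x := by
    rintro x ⟨hx, hx'⟩
    have h0 : x ≠ 0 := by linarith
    have h1 : 1 - x ≠ 0 := by linarith
    have h2 : 1 - p ≠ 0 := by linarith
    have hsub := (hasDerivAt_id x).sub_const p
    have hlog := (hasDerivAt_id x).log h0
    have hlog' := ((hasDerivAt_id x).const_sub 1).log h1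
    refine (((hsub.pow 2).div_const (2 * p * (1 - p))).add
      ((hlog.const_mul p).add (hlog'.const_mul (1 - p)))).congr_deriv ?_
    simp only [id]
    field_simp
    ring
  refine monotoneOn_of_deriv_nonneg (convex_Icc _ _)
    (fun x hx => (hderiv x hx).continuousAt.continuousWithinAt)
    (fun x hx => (hderiv x (interior_subset hx)).differentiableAt.differentiableWithinAt)
    fun x hx => ?_
  have hx := interior_subset hx
  rw [(hderiv x hx).deriv, sub_nonneg]
  obtain ⟨hx, hx'⟩ := hx
  refine div_le_div_of_nonneg_left (by linarith) (mul_pos hp (by linarith)) ?_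
  nlinarith [mul_nonneg (sub_nonneg.2 hx) (show 0 ≤ 1 - x - p by linarith)]

/-- If `0 < p`, `0 ≤ ε` and `p + ε ≤ 1/2`, then
`kl(p, p+ε) ≤ ε² / (2 p (1 - p)) ≤ ε² / p`. -/
theorem klBer_le
    (p ε : ℝ) (hp : 0 < p) (hε : 0 ≤ ε) (hpe : p + ε ≤ 1 / 2) :
    klBer p (p + ε) ≤ ε ^ 2 / (2 * p * (1 - p)) ∧
      ε ^ 2 / (2 * p * (1 - p)) ≤ ε ^ 2 / p := by
  have hp' : p ≤ 1 / 2 := by linarith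
  constructor
  · have h := monotoneOn_quadratic_add_log hp hp' ⟨le_rfl, hp'⟩
      ⟨le_add_of_nonneg_right hε, hpe⟩ (le_add_of_nonneg_right hε)
    simp only [sub_self, add_sub_cancel_left] at h
    rw [klBer, Real.log_div (by linarith) (by linarith), Real.log_div (by linarith) (by linarith)]
    norm_num at h
    linarith
  · exact div_le_div_of_nonneg_left (sq_nonneg ε) hp (by nlinarith)
end

section
/- Let M > 0 and let μ be a probability measure on ℝ supported in [0, M], with mean m = ∫ x dμ(x) and variance v = ∫ (x − m)² dμ(x). Then, as β → 0 with β ≠ 0, U_β(μ) = m + (β/2)·v + O(β²); that is, the function β ↦ U_β(μ) − m − (β/2)·v is O(β²) in a punctured neighborhood of 0. -/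
open MeasureTheory Filter Topology Asymptotics

open ProbabilityTheory in
/-- Second-order expansion of the cumulant generating function at `0`, when `0` is interior to its
domain. -/
theorem isBigO_cgf_sub_taylor_two {Ω : Type*} [MeasurableSpace Ω] {μ : Measure Ω}
    [IsProbabilityMeasure μ] {X : Ω → ℝ} (h : 0 ∈ interior (integrableExpSet X μ)) :
    (fun β : ℝ => cgf X μ β - β * (∫ ω, X ω ∂μ) - β ^ 2 / 2 * ∫ ω, (X ω - ∫ ω', X ω' ∂μ) ^ 2 ∂μ)
      =O[𝓝 0] fun β => β ^ 3 := by
  have hd : deriv (cgf X μ) 0 = ∫ ω, X ω ∂μ := by simp [deriv_cgf_zero h]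
  have hd2 : iteratedDeriv 2 (cgf X μ) 0 = ∫ ω, (X ω - ∫ ω', X ω' ∂μ) ^ 2 ∂μ := by
    simp [iteratedDeriv_two_cgf_eq_integral h, hd]
  refine (((analyticAt_cgf h).hasFPowerSeriesAt.isBigO_sub_partialSum_pow 3).norm_right.congr
    (fun β => ?_) (fun β => ?_)).of_norm_right
  · simp [FormalMultilinearSeries.partialSum, Finset.sum_range_succ, iteratedDeriv_one, hd, hd2]
    ring
  · simp

/-- Taylor expansion of the entropic risk measure around `β = 0`: for a probability
measure supported in `[0, M]` with mean `m` and variance `v`, the function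
`β ↦ U_β(μ) - m - (β/2) v` is `O(β²)` as `β → 0`, `β ≠ 0`. -/
theorem entRM_taylor_expansion
    (M : ℝ) (hM : 0 < M)
    (μ : Measure ℝ) [IsProbabilityMeasure μ]
    (hsupp : μ (Set.Icc (0 : ℝ) M) = 1) :
    (fun β : ℝ =>
        entRM β μ - (∫ x, x ∂μ) - (β / 2) * ∫ x, (x - ∫ y, y ∂μ) ^ 2 ∂μ)
      =O[𝓝[≠] (0 : ℝ)] fun β => β ^ 2 := by
  have hae : ∀ᵐ x ∂μ, x ∈ Set.Icc (0 : ℝ) M :=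
    (mem_ae_iff_prob_eq_one measurableSet_Icc).2 hsupp
  have h : (0 : ℝ) ∈ interior (ProbabilityTheory.integrableExpSet (fun x : ℝ => x) μ) := by
    have : ProbabilityTheory.integrableExpSet (fun x : ℝ => x) μ = Set.univ :=
      Set.eq_univ_of_forall fun t =>
        ProbabilityTheory.integrable_exp_mul_of_mem_Icc aemeasurable_id hae
    simp [this]
  have hO := ((isBigO_cgf_sub_taylor_two h).mono nhdsWithin_le_nhds).mul
    (isBigO_refl (fun β : ℝ => β⁻¹) (𝓝[≠] 0))
  refine hO.congr' ?_ ?_ <;> filter_upwards [self_mem_nhdsWithin] with β (hβ : β ≠ 0)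
  · simp only [entRM, ProbabilityTheory.cgf, ProbabilityTheory.mgf]
    field_simp
  · field_simp
end
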